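/- Let 𝒯 > 0, let B be a finite set of boundary nodes with lengths dl_i > 0, and let ρ_i : [0,𝒯] → ℝ (i in a finite node set I ⊇ B) be differentiable with ρ_i(t) > 0 for all t, with positive volumes V_i. Suppose there are continuous functions (v_n)_i : [0,𝒯] → ℝ for i ∈ B and data ρ_{b,i}, c_{b,i}, (v_b·n)_i with 0 < ρ_{b,i} ≤ M, 0 < c_{b,i} ≤ M and |(v_b·n)_i| ≤ M, such that for all t, d/dt ∑_{i∈I} V_i ρ_i(t) = − ∑_{i∈B} φ_i(t) dl_i, where φ_i(t) = ρ_i(t)(v_n)_i(t) if (v_n)_i(t) ≥ 0 (outflow), φ_i(t) = ρ_{b,i}(v_n)_i(t) if −c_{b,i} ≤ (v_n)_i(t) < 0 (subsonic inflow), and φ_i(t) = ρ_{b,i}(v_b·n)_i if (v_n)_i(t) < −c_{b,i} (supersonic inflow). Then, with L = ∑_{i∈B} dl_i, for all t ∈ [0,𝒯]: ∑_{i∈I} V_i ρ_i(t) ≤ ∑_{i∈I} V_i ρ_i(0) + M² L t, and the time-integrated discrete mass outflow is bounded: ∫_0^𝒯 ∑_{i∈B} max((v_n)_i(t),0) ρ_i(t)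 dl_i dt ≤ ∑_{i∈I} V_i ρ_i(0) + M² L 𝒯. -/

import Mathlib

open Set

/-- The inflow/outflow boundary flux exceeds its outflow part by at least `-M ^ 2`. -/
theorem outflow_sub_sq_le_flux {r v rb cb vb M : ℝ} (hrb : 0 < rb ∧ rb ≤ M)
    (hcb : 0 < cb ∧ cb ≤ M) (hvb : |vb| ≤ M) :
    max v 0 * r - M ^ 2 ≤
      if 0 ≤ v then r * v else if -cb ≤ v then rb * v else rb * vb := by
  have hM : 0 ≤ M := hrb.1.le.trans hrb.2
  have inflow {w : ℝ} (hw : -M ≤ w) : -M ^ 2 ≤ rb * w := by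
    nlinarith [mul_le_mul_of_nonneg_left hw hrb.1.le, mul_le_mul_of_nonneg_right hrb.2 hM]
  split_ifs with h0 h1
  · rw [max_eq_left h0]
    nlinarith [sq_nonneg M]
  · rw [max_eq_right (not_le.mp h0).le]
    linarith [inflow ((neg_le_neg hcb.2).trans h1)]
  · rw [max_eq_right (not_le.mp h0).le]
    linarith [inflow (abs_le.mp hvb).1]

/-- A function whose derivative is at most `K - g` satisfies the integrated inequality. -/
theorem add_integral_le_of_hasDerivAt_le {T K : ℝ} {F F' g : ℝ → ℝ} (hg : Continuous g)
    (hF : ∀ t ∈ Icc (0 : ℝ) T, HasDerivAt F (F' t) t)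
    (hle : ∀ t ∈ Icc (0 : ℝ) T, F' t ≤ K - g t) {t : ℝ} (ht : t ∈ Icc (0 : ℝ) T) :
    F t + ∫ s in (0 : ℝ)..t, g s ≤ F 0 + K * t := by
  have hd : ∀ x ∈ Icc (0 : ℝ) T,
      HasDerivAt (fun x => F x + (∫ s in (0 : ℝ)..x, g s) - K * x) (F' x + g x - K * 1) x :=
    fun x hx => ((hF x hx).add (hg.integral_hasStrictDerivAt 0 x).hasDerivAt).sub
      ((hasDerivAt_id x).const_mul K)
  have hanti : AntitoneOn (fun x => F x + (∫ s in (0 : ℝ)..x, g s) - K * x) (Icc 0 T) := by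
    refine antitoneOn_of_hasDerivWithinAt_nonpos (convex_Icc 0 T)
      (fun x hx => (hd x hx).continuousAt.continuousWithinAt)
      (fun x hx => (hd x (interior_subset hx)).hasDerivWithinAt) fun x hx => ?_
    linarith [hle x (interior_subset hx)]
  have h := hanti (left_mem_Icc.mpr (ht.1.trans ht.2)) ht ht.1
  simp only [intervalIntegral.integral_same] at h
  linarith

/-- semi-discrete a priori mass bound for the finite-volume scheme with
the proposed inflow/outflow boundary fluxes: the total discrete mass grows at most
linearly with rate `M² ∑ dl_i`, and the time-integrated discrete mass outflow is
bounded by the initial mass plus `M² L 𝒯`. -/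
theorem stmt_13 {I : Type*} [Fintype I] [DecidableEq I]
    (𝒯 : ℝ) (h𝒯 : 0 < 𝒯)
    (B : Finset I) (dl : I → ℝ) (hdl : ∀ i ∈ B, 0 < dl i)
    (V : I → ℝ) (hV : ∀ i, 0 < V i)
    (ρ : I → ℝ → ℝ) (hρdiff : ∀ i, Differentiable ℝ (ρ i))
    (hρpos : ∀ i, ∀ t ∈ Icc (0 : ℝ) 𝒯, 0 < ρ i t)
    (vn : I → ℝ → ℝ) (hvncont : ∀ i ∈ B, Continuous (vn i))
    (ρb cb vbn : I → ℝ) (M : ℝ)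
    (hρb : ∀ i ∈ B, 0 < ρb i ∧ ρb i ≤ M)
    (hcb : ∀ i ∈ B, 0 < cb i ∧ cb i ≤ M)
    (hvbn : ∀ i ∈ B, |vbn i| ≤ M)
    (φ : I → ℝ → ℝ)
    (hφ : ∀ i ∈ B, ∀ t : ℝ,
      φ i t = if 0 ≤ vn i t then ρ i t * vn i t
        else if -cb i ≤ vn i t then ρb i * vn i t
        else ρb i * vbn i)
    (hbal : ∀ t ∈ Icc (0 : ℝ) 𝒯,
      HasDerivAt (fun s => ∑ i, V i * ρ i s) (-∑ i ∈ B, φ i t * dl i) t) :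
    (∀ t ∈ Icc (0 : ℝ) 𝒯,
      ∑ i, V i * ρ i t ≤ ∑ i, V i * ρ i 0 + M ^ 2 * (∑ i ∈ B, dl i) * t) ∧
    (∫ t in (0 : ℝ)..𝒯, ∑ i ∈ B, max (vn i t) 0 * ρ i t * dl i)
      ≤ ∑ i, V i * ρ i 0 + M ^ 2 * (∑ i ∈ B, dl i) * 𝒯 := by
  set g : ℝ → ℝ := fun t => ∑ i ∈ B, max (vn i t) 0 * ρ i t * dl i with hg
  have hgcont : Continuous g := continuous_finsetSum _ fun i hi =>
    (((hvncont i hi).max continuous_const).mul (hρdiff i).continuous).mul continuous_const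
  have hg0 : ∀ t ∈ Icc (0 : ℝ) 𝒯, 0 ≤ g t := fun t ht => Finset.sum_nonneg fun i hi =>
    mul_nonneg (mul_nonneg (le_max_right _ _) (hρpos i t ht).le) (hdl i hi).le
  have hrate : ∀ t ∈ Icc (0 : ℝ) 𝒯,
      -∑ i ∈ B, φ i t * dl i ≤ M ^ 2 * (∑ i ∈ B, dl i) - g t := by
    intro t _
    rw [hg, Finset.mul_sum, ← Finset.sum_sub_distrib, ← Finset.sum_neg_distrib]
    refine Finset.sum_le_sum fun i hi => ?_
    have h := outflow_sub_sq_le_flux (r := ρ i t) (v := vn i t)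
      (hρb i hi) (hcb i hi) (hvbn i hi)
    rw [← hφ i hi t] at h
    linarith [mul_le_mul_of_nonneg_right h (hdl i hi).le]
  have hmass : ∀ t ∈ Icc (0 : ℝ) 𝒯, (∑ i, V i * ρ i t) + ∫ s in (0 : ℝ)..t, g s ≤
      ∑ i, V i * ρ i 0 + M ^ 2 * (∑ i ∈ B, dl i) * t := fun t ht =>
    add_integral_le_of_hasDerivAt_le hgcont hbal hrate ht
  refine ⟨fun t ht => ?_, ?_⟩
  · have hint : 0 ≤ ∫ s in (0 : ℝ)..t, g s :=
      intervalIntegral.integral_nonneg ht.1 fun s hs => hg0 s ⟨hs.1, hs.2.trans ht.2⟩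
    linarith [hmass t ht]
  · have hT : 𝒯 ∈ Icc (0 : ℝ) 𝒯 := right_mem_Icc.mpr h𝒯.le
    have hpos : 0 ≤ ∑ i, V i * ρ i 𝒯 :=
      Finset.sum_nonneg fun i _ => mul_nonneg (hV i).le (hρpos i 𝒯 hT).le
    linarith [hmass 𝒯 hT]
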